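/- Let {f_i}_{i∈I_c} and {g_j}_{j∈I_d} be families of flow and jump maps, let h⁰, h ∈ H, let J ⊂ I_c × I_c × I_d be nonempty, and let SW ⊂ SW(J) be a family of impulsive and switching sequences. Let Assumption 3 hold. If there exist η, μ > 0 such that for every σ ∈ SW, n^{σ,s}_{(t_0,t]} ln(d_s) + n^{σ,u}_{(t_0,t]} ln(d_u) − c_s T^{σ,s}_{(t_0,t]} + c_u T^{σ,u}_{(t_0,t]} ≤ μ − η(t−t_0) for all t ≥ t_0 ≥ 0 (with the conventions 0·ln(0) = 0 and r·ln(0) = −∞ for r > 0), then the family {Σ_σ}_{σ∈SW} is weakly (h⁰,h)-ISS. -/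

import Mathlib

open MeasureTheory Filter Set
open scoped Classical

noncomputable section

/-- State/input spaces: `ℝ^k` with the Euclidean norm. -/
abbrev Stt (k : ℕ) : Type := EuclideanSpace ℝ (Fin k)

/-- An impulse-time sequence, identified with its (locally finite) set of impulse
times, a subset of `(0,∞)` with finitely many points below any bound. -/
def IsImpulseSeq (γ : Set ℝ) : Prop :=
  γ ⊆ Set.Ioi (0 : ℝ) ∧ ∀ T : ℝ, (γ ∩ Set.Iic T).Finite

/-- `n^γ_{(s,t]}`: the number of impulse times in the interval `(s,t]`. -/
def nJumps (γ : Set ℝ) (s t : ℝ) : ℕ := (γ ∩ Set.Ioc s t).ncard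

/-- Uniform incremental boundedness of a set of impulse-time sequences. -/
def UIB (S : Set (Set ℝ)) : Prop :=
  ∃ φ : ℝ → ℝ, ContinuousOn φ (Set.Ici 0) ∧ MonotoneOn φ (Set.Ici 0) ∧
    (∀ s : ℝ, 0 ≤ s → 0 ≤ φ s) ∧
    ∀ γ ∈ S, ∀ t0 t : ℝ, 0 ≤ t0 → t0 < t → (nJumps γ t0 t : ℝ) ≤ φ (t - t0)

/-- Class `K∞` functions `[0,∞) → [0,∞)`. -/
def ClassKInf (α : ℝ → ℝ) : Prop :=
  ContinuousOn α (Set.Ici 0) ∧ StrictMonoOn α (Set.Ici 0) ∧ α 0 = 0 ∧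
    ∀ M : ℝ, ∃ r : ℝ, 0 ≤ r ∧ M ≤ α r

/-- Class `KL` functions. -/
def ClassKL (β : ℝ → ℝ → ℝ) : Prop :=
  (∀ t : ℝ, 0 ≤ t → ClassKInf fun r => β r t) ∧
  ∀ r : ℝ, 0 ≤ r → AntitoneOn (fun t => β r t) (Set.Ici 0) ∧
    Filter.Tendsto (fun t => β r t) Filter.atTop (nhds 0)

/-- Positive definite functions `[0,∞) → [0,∞)`. -/
def PosDef (ρ : ℝ → ℝ) : Prop :=
  ContinuousOn ρ (Set.Ici 0) ∧ ρ 0 = 0 ∧ ∀ r : ℝ, 0 < r → 0 < ρ r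

/-- Locally integrable (on compacts) function `[0,∞) → ℝ` (extended to `ℝ`). -/
def LocIntegrable (p : ℝ → ℝ) : Prop :=
  ∀ a b : ℝ, MeasureTheory.IntegrableOn p (Set.Icc a b)

/-- Inputs: measurable, locally essentially bounded functions. -/
def IsInput {m : ℕ} (u : ℝ → Stt m) : Prop :=
  Measurable u ∧ ∀ T : ℝ, ∃ C : ℝ, ∀ᵐ t ∂MeasureTheory.volume, t ∈ Set.Icc 0 T → ‖u t‖ ≤ C

/-- `‖u_I‖_γ`: max of the essential supremum of `‖u‖` over `I` and the supremum of
`‖u‖` over `γ ∩ I`. -/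
def inputNorm {m : ℕ} (γ : Set ℝ) (u : ℝ → Stt m) (I : Set ℝ) : ℝ :=
  max (essSup (fun t => ‖u t‖) (MeasureTheory.volume.restrict I))
      (sSup ((fun t => ‖u t‖) '' (γ ∩ I)))

/-- Solution of the impulsive system `(γ,f,g)` on `[t0,T)` with initial state `x0`
and input `u` (Carathéodory solutions, in integral form, between impulses). -/
structure IsSolution {n m : ℕ} (γ : Set ℝ) (f g : ℝ → Stt n → Stt m → Stt n)
    (t0 : ℝ) (x0 : Stt n) (u : ℝ → Stt m) (T : EReal) (x : ℝ → Stt n) : Prop where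
  lt : (t0 : EReal) < T
  init : x t0 = x0
  flow : ∀ t1 t2 : ℝ, t0 ≤ t1 → t1 ≤ t2 → (t2 : EReal) < T → Set.Ioc t1 t2 ∩ γ = ∅ →
    MeasureTheory.IntegrableOn (fun s => f s (x s) (u s)) (Set.Icc t1 t2) ∧
    x t2 = x t1 + ∫ s in t1..t2, f s (x s) (u s)
  jump : ∀ t ∈ γ, t0 < t → (t : EReal) < T →
    ∃ L : Stt n, Filter.Tendsto x (nhdsWithin t (Set.Iio t)) (nhds L) ∧
      x t = L + g t L (u t)

/-- Maximally defined solution. -/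
def IsMaxSolution {n m : ℕ} (γ : Set ℝ) (f g : ℝ → Stt n → Stt m → Stt n)
    (t0 : ℝ) (x0 : Stt n) (u : ℝ → Stt m) (T : EReal) (x : ℝ → Stt n) : Prop :=
  IsSolution γ f g t0 x0 u T x ∧
    ∀ (T' : EReal) (x' : ℝ → Stt n), IsSolution γ f g t0 x0 u T' x' →
      (∀ t : ℝ, t0 ≤ t → (t : EReal) < T → x' t = x t) → T' ≤ T

/-- Weak `(h⁰,h)`-ISS of a parametrized family of impulsive systems. -/
def WeaklyISS {n m : ℕ} {Λ : Type*} (γ : Λ → Set ℝ)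
    (f g : Λ → ℝ → Stt n → Stt m → Stt n) (h0 h : ℝ → Stt n → ℝ) : Prop :=
  ∃ β : ℝ → ℝ → ℝ, ∃ ρ : ℝ → ℝ, ClassKL β ∧ ClassKInf ρ ∧
    ∀ (l : Λ) (t0 : ℝ) (x0 : Stt n) (u : ℝ → Stt m) (T : EReal) (x : ℝ → Stt n),
      0 ≤ t0 → IsInput u → IsMaxSolution (γ l) (f l) (g l) t0 x0 u T x →
      ∀ t : ℝ, t0 ≤ t → (t : EReal) < T →
        h t (x t) ≤ β (h0 t0 x0) (t - t0) + ρ (inputNorm (γ l) u (Set.Ioc t0 t))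

/-- Strong `(h⁰,h)`-ISS of a parametrized family of impulsive systems. -/
def StronglyISS {n m : ℕ} {Λ : Type*} (γ : Λ → Set ℝ)
    (f g : Λ → ℝ → Stt n → Stt m → Stt n) (h0 h : ℝ → Stt n → ℝ) : Prop :=
  ∃ β : ℝ → ℝ → ℝ, ∃ ρ : ℝ → ℝ, ClassKL β ∧ ClassKInf ρ ∧
    ∀ (l : Λ) (t0 : ℝ) (x0 : Stt n) (u : ℝ → Stt m) (T : EReal) (x : ℝ → Stt n),
      0 ≤ t0 → IsInput u → IsMaxSolution (γ l) (f l) (g l) t0 x0 u T x →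
      ∀ t : ℝ, t0 ≤ t → (t : EReal) < T →
        h t (x t) ≤ β (h0 t0 x0) (t - t0 + (nJumps (γ l) t0 t : ℝ)) +
          ρ (inputNorm (γ l) u (Set.Ioc t0 t))

/-- Locally Lipschitz on a set. -/
def LocLipschitzOn {α β : Type*} [PseudoEMetricSpace α] [PseudoEMetricSpace β]
    (s : Set α) (f : α → β) : Prop :=
  ∀ x ∈ s, ∃ K : NNReal, ∃ t ∈ nhdsWithin x s, LipschitzOnWith K f t

/-- `V ∈ V(γ)` with `Vm` its left-limit function at impulse times: `V` is locally
Lipschitz on each inter-impulse strip and has the joint left limit `Vm τ ξ`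
at each `τ ∈ γ`. -/
def InClassV {n : ℕ} (γ : Set ℝ) (V Vm : ℝ → Stt n → ℝ) : Prop :=
  (∀ a b : ℝ, 0 ≤ a → Set.Ioo a b ∩ γ = ∅ →
    LocLipschitzOn (Set.Ico a b ×ˢ (Set.univ : Set (Stt n)))
      (fun q : ℝ × Stt n => V q.1 q.2)) ∧
  ∀ τ ∈ γ, ∀ ξ : Stt n,
    Filter.Tendsto (fun q : ℝ × Stt n => V q.1 q.2)
      (nhdsWithin (τ, ξ) (Set.Iio τ ×ˢ (Set.univ : Set (Stt n)))) (nhds (Vm τ ξ))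

/-- Upper-right Dini derivative of `V` along the flow map `f`. -/
def DiniAlong {n m : ℕ} (f : ℝ → Stt n → Stt m → Stt n) (V : ℝ → Stt n → ℝ)
    (t : ℝ) (ξ : Stt n) (μ : Stt m) : ℝ :=
  Filter.limsup (fun d : ℝ => (V (t + d) (ξ + d • f t ξ μ) - V t ξ) / d)
    (nhdsWithin 0 (Set.Ioi 0))

/-- Carathéodory function `[0,∞) × [0,∞) → ℝ`. -/
def Caratheodory2 (φ : ℝ → ℝ → ℝ) : Prop :=
  (∀ r : ℝ, Measurable fun t => φ t r) ∧
  (∀ t : ℝ, ContinuousOn (φ t) (Set.Ici 0)) ∧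
  ∀ a b c : ℝ, ∃ mK : ℝ → ℝ, MeasureTheory.IntegrableOn mK (Set.Icc a b) ∧
    ∀ t ∈ Set.Icc a b, ∀ r ∈ Set.Icc (0 : ℝ) c, |φ t r| ≤ mK t

/-- Assumption 1 of the paper, with all the data explicit. -/
def Assumption1 {n m : ℕ} {Λ : Type*} (γ : Λ → Set ℝ)
    (f g : Λ → ℝ → Stt n → Stt m → Stt n) (h0 h : ℝ → Stt n → ℝ)
    (V Vm : Λ → ℝ → Stt n → ℝ) (φ1 φ2 χ π : ℝ → ℝ)
    (vφ al : Λ → ℝ → ℝ → ℝ) : Prop :=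
  ClassKInf φ1 ∧ ClassKInf φ2 ∧ ClassKInf χ ∧ ClassKInf π ∧
  (∀ l : Λ, InClassV (γ l) (V l) (Vm l)) ∧
  (∀ l : Λ, Caratheodory2 (vφ l)) ∧
  (∀ (l : Λ) (t r : ℝ), 0 ≤ t → 0 ≤ r → 0 ≤ al l t r) ∧
  (∀ (l : Λ) (t : ℝ) (ξ : Stt n), 0 ≤ t →
    φ1 (h t ξ) ≤ V l t ξ ∧ V l t ξ ≤ φ2 (h0 t ξ)) ∧
  (∀ (l : Λ) (t : ℝ) (ξ : Stt n) (μ : Stt m), 0 ≤ t → t ∉ γ l → χ ‖μ‖ ≤ V l t ξ →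
    DiniAlong (f l) (V l) t ξ μ ≤ - vφ l t (V l t ξ)) ∧
  (∀ (l : Λ) (t : ℝ) (ξ : Stt n) (μ : Stt m), t ∈ γ l → χ ‖μ‖ ≤ Vm l t ξ →
    V l t (ξ + g l t ξ μ) ≤ al l t (Vm l t ξ)) ∧
  (∀ (l : Λ) (t : ℝ) (ξ : Stt n) (μ : Stt m), t ∈ γ l → Vm l t ξ ≤ χ ‖μ‖ →
    V l t (ξ + g l t ξ μ) ≤ π ‖μ‖)

/-- Solution of the scalar comparison differential/difference inclusion. -/
structure IsCompSol (γ : Set ℝ) (vφ al : ℝ → ℝ → ℝ) (t0 z0 : ℝ) (T : EReal)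
    (z : ℝ → ℝ) : Prop where
  lt : (t0 : EReal) < T
  init : z t0 = z0
  nonneg : ∀ t : ℝ, t0 ≤ t → (t : EReal) < T → 0 ≤ z t
  flow : ∀ t1 t2 : ℝ, t0 ≤ t1 → t1 ≤ t2 → (t2 : EReal) < T → Set.Ioc t1 t2 ∩ γ = ∅ →
    ∃ d : ℝ → ℝ, MeasureTheory.IntegrableOn d (Set.Icc t1 t2) ∧
      (∀ᵐ s ∂MeasureTheory.volume, s ∈ Set.Icc t1 t2 → d s ≤ - vφ s (z s)) ∧
      ∀ t ∈ Set.Icc t1 t2, z t = z t1 + ∫ s in t1..t, d s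
  jump : ∀ t ∈ γ, t0 < t → (t : EReal) < T →
    ∃ L : ℝ, Filter.Tendsto z (nhdsWithin t (Set.Iio t)) (nhds L) ∧ z t ≤ al t L

/-- The family of comparison systems is weakly GUAS. -/
def CompWeakGUAS {Λ : Type*} (γ : Λ → Set ℝ) (vφ al : Λ → ℝ → ℝ → ℝ) : Prop :=
  ∃ β : ℝ → ℝ → ℝ, ClassKL β ∧
    ∀ (l : Λ) (t0 z0 : ℝ) (T : EReal) (z : ℝ → ℝ), 0 ≤ t0 → 0 ≤ z0 →
      IsCompSol (γ l) (vφ l) (al l) t0 z0 T z →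
      ∀ t : ℝ, t0 ≤ t → (t : EReal) < T → z t ≤ β z0 (t - t0)

/-- The family of comparison systems is strongly GUAS. -/
def CompStrongGUAS {Λ : Type*} (γ : Λ → Set ℝ) (vφ al : Λ → ℝ → ℝ → ℝ) : Prop :=
  ∃ β : ℝ → ℝ → ℝ, ClassKL β ∧
    ∀ (l : Λ) (t0 z0 : ℝ) (T : EReal) (z : ℝ → ℝ), 0 ≤ t0 → 0 ≤ z0 →
      IsCompSol (γ l) (vφ l) (al l) t0 z0 T z →
      ∀ t : ℝ, t0 ≤ t → (t : EReal) < T → z t ≤ β z0 (t - t0 + (nJumps (γ l) t0 t : ℝ))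

/-- Nonnegative Carathéodory solution of the scalar ODE `ẇ = rhs(t,w)` on `[t0,T)`. -/
structure IsODESol (rhs : ℝ → ℝ → ℝ) (t0 : ℝ) (T : EReal) (w : ℝ → ℝ) : Prop where
  lt : (t0 : EReal) < T
  nonneg : ∀ t : ℝ, t0 ≤ t → (t : EReal) < T → 0 ≤ w t
  flow : ∀ t1 t2 : ℝ, t0 ≤ t1 → t1 ≤ t2 → (t2 : EReal) < T →
    IntervalIntegrable (fun s => rhs s (w s)) MeasureTheory.volume t1 t2 ∧
    w t2 = w t1 + ∫ s in t1..t2, rhs s (w s)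

/-- Maximally defined forward-in-time solution of `ẇ = rhs(t,w)`. -/
def IsMaxODESol (rhs : ℝ → ℝ → ℝ) (t0 : ℝ) (T : EReal) (w : ℝ → ℝ) : Prop :=
  IsODESol rhs t0 T w ∧
    ∀ (T' : EReal) (w' : ℝ → ℝ), IsODESol rhs t0 T' w' →
      (∀ t : ℝ, t0 ≤ t → (t : EReal) < T → w' t = w t) → T' ≤ T

/-- GUAS of the family of scalar ODEs `ẇ = −φ_λ(t,w)`. -/
def ODEFamilyGUAS {Λ : Type*} (vφ : Λ → ℝ → ℝ → ℝ) : Prop :=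
  ∃ β : ℝ → ℝ → ℝ, ClassKL β ∧
    ∀ (l : Λ) (t0 : ℝ) (T : EReal) (w : ℝ → ℝ), 0 ≤ t0 →
      IsMaxODESol (fun s r => -(vφ l s r)) t0 T w →
      T = (⊤ : EReal) ∧ ∀ t : ℝ, t0 ≤ t → w t ≤ β (w t0) (t - t0)

/-- Solution (on all of `[0,∞)`) of the scalar linear ODE `ẇ = −p(t)·w`. -/
def IsLinSol (p : ℝ → ℝ) (w : ℝ → ℝ) : Prop :=
  ∀ t1 t2 : ℝ, 0 ≤ t1 → t1 ≤ t2 →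
    IntervalIntegrable (fun s => p s * w s) MeasureTheory.volume t1 t2 ∧
    w t2 = w t1 + ∫ s in t1..t2, -(p s * w s)

/-- An impulsive and switching sequence, described through its impulse-time set,
its two switching signals (constant between impulses), and the left limit of the
first switching signal at impulse times. -/
structure SwSignal (Ic Id : Type*) where
  γ : Set ℝ
  σ1 : ℝ → Ic
  σ1m : ℝ → Ic
  σ2 : ℝ → Id
  impulse : IsImpulseSeq γ
  const1 : ∀ a b : ℝ, 0 ≤ a → Set.Ioo a b ∩ γ = ∅ → ∀ t ∈ Set.Ico a b, σ1 t = σ1 a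
  const2 : ∀ a b : ℝ, 0 ≤ a → Set.Ioo a b ∩ γ = ∅ → ∀ t ∈ Set.Ico a b, σ2 t = σ2 a
  leftlim : ∀ t ∈ γ, ∀ᶠ s in nhdsWithin t (Set.Iio t), σ1 s = σ1m t

/-- `σ ∈ SW(J)`. -/
def InSW {Ic Id : Type*} (σ : SwSignal Ic Id) (J : Set (Ic × Ic × Id)) : Prop :=
  ∀ t ∈ σ.γ, (σ.σ1m t, σ.σ1 t, σ.σ2 t) ∈ J

/-- Flow map of the switched impulsive system `Σ_σ`. -/
def swF {n m : ℕ} {Ic Id : Type*} (F : Ic → ℝ → Stt n → Stt m → Stt n)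
    (σ : SwSignal Ic Id) : ℝ → Stt n → Stt m → Stt n :=
  fun t ξ μ => F (σ.σ1 t) t ξ μ

/-- Jump map of the switched impulsive system `Σ_σ`. -/
def swG {n m : ℕ} {Ic Id : Type*} (G : Id → ℝ → Stt n → Stt m → Stt n)
    (σ : SwSignal Ic Id) : ℝ → Stt n → Stt m → Stt n :=
  fun t ξ μ => G (σ.σ2 t) t ξ μ

/-- Weak `(h⁰,h)`-ISS of the family `{Σ_σ}_{σ ∈ SW}`. -/
def SwWeaklyISS {n m : ℕ} {Ic Id : Type*} (F : Ic → ℝ → Stt n → Stt m → Stt n)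
    (G : Id → ℝ → Stt n → Stt m → Stt n) (SW : Set (SwSignal Ic Id))
    (h0 h : ℝ → Stt n → ℝ) : Prop :=
  ∃ β : ℝ → ℝ → ℝ, ∃ ρ : ℝ → ℝ, ClassKL β ∧ ClassKInf ρ ∧
    ∀ σ ∈ SW, ∀ (t0 : ℝ) (x0 : Stt n) (u : ℝ → Stt m) (T : EReal) (x : ℝ → Stt n),
      0 ≤ t0 → IsInput u → IsMaxSolution σ.γ (swF F σ) (swG G σ) t0 x0 u T x →
      ∀ t : ℝ, t0 ≤ t → (t : EReal) < T →
        h t (x t) ≤ β (h0 t0 x0) (t - t0) + ρ (inputNorm σ.γ u (Set.Ioc t0 t))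

/-- Strong `(h⁰,h)`-ISS of the family `{Σ_σ}_{σ ∈ SW}`. -/
def SwStronglyISS {n m : ℕ} {Ic Id : Type*} (F : Ic → ℝ → Stt n → Stt m → Stt n)
    (G : Id → ℝ → Stt n → Stt m → Stt n) (SW : Set (SwSignal Ic Id))
    (h0 h : ℝ → Stt n → ℝ) : Prop :=
  ∃ β : ℝ → ℝ → ℝ, ∃ ρ : ℝ → ℝ, ClassKL β ∧ ClassKInf ρ ∧
    ∀ σ ∈ SW, ∀ (t0 : ℝ) (x0 : Stt n) (u : ℝ → Stt m) (T : EReal) (x : ℝ → Stt n),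
      0 ≤ t0 → IsInput u → IsMaxSolution σ.γ (swF F σ) (swG G σ) t0 x0 u T x →
      ∀ t : ℝ, t0 ≤ t → (t : EReal) < T →
        h t (x t) ≤ β (h0 t0 x0) (t - t0 + (nJumps σ.γ t0 t : ℝ)) +
          ρ (inputNorm σ.γ u (Set.Ioc t0 t))

/-- Total activation time in `(t0,t]` of the flow modes in `A`. -/
def actT {Ic Id : Type*} (σ : SwSignal Ic Id) (A : Set Ic) (t0 t : ℝ) : ℝ :=
  (MeasureTheory.volume {r : ℝ | r ∈ Set.Ioc t0 t ∧ σ.σ1 r ∈ A}).toReal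

/-- Number of impulse times in `(t0,t]` whose mode combination lies in `Jp`. -/
def nJumpsIn {Ic Id : Type*} (σ : SwSignal Ic Id) (Jp : Set (Ic × Ic × Id))
    (t0 t : ℝ) : ℕ :=
  (σ.γ ∩ Set.Ioc t0 t ∩ {r : ℝ | (σ.σ1m r, σ.σ1 r, σ.σ2 r) ∈ Jp}).ncard

/-- Assumption 2 of the paper (for switched impulsive systems), data explicit. -/
def Assumption2 {n m : ℕ} {Ic Id : Type*}
    (F : Ic → ℝ → Stt n → Stt m → Stt n) (G : Id → ℝ → Stt n → Stt m → Stt n)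
    (h0 h : ℝ → Stt n → ℝ) (J : Set (Ic × Ic × Id))
    (v : Ic → ℝ → Stt n → ℝ) (φ1 φ2 χ π : ℝ → ℝ)
    (vφ : Ic → ℝ → ℝ → ℝ) (al : Ic × Ic × Id → ℝ → ℝ → ℝ) : Prop :=
  ClassKInf φ1 ∧ ClassKInf φ2 ∧ ClassKInf χ ∧ ClassKInf π ∧
  (∀ i : Ic, LocLipschitzOn ((Set.Ici (0 : ℝ)) ×ˢ (Set.univ : Set (Stt n)))
      (fun q : ℝ × Stt n => v i q.1 q.2)) ∧
  (∀ i : Ic, Caratheodory2 (vφ i)) ∧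
  (∀ e ∈ J, ∀ t r : ℝ, 0 ≤ t → 0 ≤ r → 0 ≤ al e t r) ∧
  (∀ (i : Ic) (t : ℝ) (ξ : Stt n), 0 ≤ t →
    φ1 (h t ξ) ≤ v i t ξ ∧ v i t ξ ≤ φ2 (h0 t ξ)) ∧
  (∀ (i : Ic) (t : ℝ) (ξ : Stt n) (μ : Stt m), 0 ≤ t → χ ‖μ‖ ≤ v i t ξ →
    DiniAlong (F i) (v i) t ξ μ ≤ - vφ i t (v i t ξ)) ∧
  (∀ (ι i : Ic) (j : Id), (ι, i, j) ∈ J → ∀ (t : ℝ) (ξ : Stt n) (μ : Stt m),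
    0 ≤ t → χ ‖μ‖ ≤ v ι t ξ → v i t (ξ + G j t ξ μ) ≤ al (ι, i, j) t (v ι t ξ)) ∧
  (∀ (ι i : Ic) (j : Id), (ι, i, j) ∈ J → ∀ (t : ℝ) (ξ : Stt n) (μ : Stt m),
    0 ≤ t → v ι t ξ ≤ χ ‖μ‖ → v i t (ξ + G j t ξ μ) ≤ π ‖μ‖)

/-! ### Absolutely continuous functions -/

theorem AbsolutelyContinuousOnInterval.of_dist_le {X Y : Type*} [PseudoMetricSpace X]
    [PseudoMetricSpace Y] {f : ℝ → X} {g : ℝ → Y} {a b K : ℝ}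
    (hg : AbsolutelyContinuousOnInterval g a b)
    (hfg : ∀ s ∈ uIcc a b, ∀ r ∈ uIcc a b, dist (f s) (f r) ≤ K * dist (g s) (g r)) :
    AbsolutelyContinuousOnInterval f a b := by
  have hlim := Filter.Tendsto.const_mul K hg
  rw [mul_zero] at hlim
  refine squeeze_zero' (Eventually.of_forall fun E => Finset.sum_nonneg fun _ _ => dist_nonneg)
    ?_ hlim
  filter_upwards [mem_inf_of_right (mem_principal_self _)] with E hE
  rw [Finset.mul_sum]
  exact Finset.sum_le_sum fun i hi => hfg _ (hE.1 i hi).1 _ (hE.1 i hi).2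

/-- Gronwall's inequality for absolutely continuous functions. -/
theorem AbsolutelyContinuousOnInterval.le_exp_mul {y : ℝ → ℝ} {a b c : ℝ} (hab : a ≤ b)
    (hy : AbsolutelyContinuousOnInterval y a b)
    (hder : ∀ᵐ s, s ∈ Ioo a b → ∀ y', HasDerivAt y y' s → y' ≤ -(c * y s)) :
    y b ≤ Real.exp (-(c * (b - a))) * y a := by
  have hexp : AbsolutelyContinuousOnInterval (fun s => Real.exp (c * (s - a))) a b :=
    ContDiffOn.absolutelyContinuousOnInterval
      ((by fun_prop : ContDiff ℝ 1 fun s => Real.exp (c * (s - a))).contDiffOn)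
  have hint := (hexp.fun_mul hy).integral_deriv_eq_sub
  have hle : ∫ s in a..b, deriv (fun s => Real.exp (c * (s - a)) * y s) s ≤ 0 := by
    rw [intervalIntegral.integral_of_le hab, integral_Ioc_eq_integral_Ioo]
    refine integral_nonpos_of_ae ?_
    rw [EventuallyLE, ae_restrict_iff' measurableSet_Ioo]
    filter_upwards [hder, hy.ae_differentiableAt] with s hs hd hmem
    have hd' := (hd (by rw [uIcc_of_le hab]; exact Ioo_subset_Icc_self hmem)).hasDerivAt
    have he : HasDerivAt (fun s => Real.exp (c * (s - a))) (Real.exp (c * (s - a)) * c) s := by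
      simpa using (((hasDerivAt_id s).sub_const a).const_mul c).exp
    rw [(he.fun_mul hd').deriv]
    have := mul_le_mul_of_nonneg_left (hs hmem _ hd') (Real.exp_pos (c * (s - a))).le
    simp only [Pi.zero_apply]
    nlinarith
  rw [hint] at hle
  have h1 : Real.exp (c * (b - a)) * y b ≤ y a := by simpa using hle
  rw [Real.exp_neg, inv_mul_eq_div, le_div_iff₀ (Real.exp_pos _)]
  linarith

theorem LocLipschitzOn.absolutelyContinuousOnInterval {E : Type*} [NormedAddCommGroup E]
    [NormedSpace ℝ E] {V : ℝ → E → ℝ} {x w : ℝ → E} {a b : ℝ}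
    (hV : LocLipschitzOn (Ici (0 : ℝ) ×ˢ (univ : Set E)) fun q : ℝ × E => V q.1 q.2)
    (ha : 0 ≤ a) (hab : a ≤ b) (hw : IntegrableOn w (Icc a b))
    (hx : ∀ s ∈ Icc a b, x s = x a + ∫ r in a..s, w r) :
    AbsolutelyContinuousOnInterval (fun s => V s (x s)) a b := by
  have hwi : IntervalIntegrable w volume a b :=
    (intervalIntegrable_iff_integrableOn_Icc_of_le hab).2 hw
  have hsub : ∀ s ∈ Icc a b, ∀ r ∈ Icc a b, IntervalIntegrable w volume s r := fun s hs r hr =>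
    hwi.mono_set (by rw [uIcc_of_le hab]; exact uIcc_subset_Icc hs hr)
  have hxsub : ∀ s ∈ Icc a b, ∀ r ∈ Icc a b, x s - x r = ∫ z in r..s, w z := by
    intro s hs r hr
    rw [hx s hs, hx r hr, add_sub_add_left_eq_sub, intervalIntegral.integral_interval_sub_left
      (hsub a (left_mem_Icc.2 hab) s hs) (hsub a (left_mem_Icc.2 hab) r hr)]
  have hxc : ContinuousOn x (Icc a b) := by
    have := (intervalIntegral.continuousOn_primitive_interval' hwi left_mem_uIcc)
    rw [uIcc_of_le hab] at this
    exact (continuousOn_const.add this).congr hx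
  set C : Set (ℝ × E) := (fun s => (s, x s)) '' Icc a b
  have hCc : IsCompact C := isCompact_Icc.image_of_continuousOn (continuousOn_id.prodMk hxc)
  have hCs : C ⊆ Ici (0 : ℝ) ×ˢ (univ : Set E) := by
    rintro _ ⟨s, hs, rfl⟩
    exact ⟨ha.trans hs.1, mem_univ _⟩
  have hVC : LocallyLipschitzOn C fun q : ℝ × E => V q.1 q.2 := by
    intro q hq
    obtain ⟨K, t, ht, hK⟩ := hV q (hCs hq)
    exact ⟨K, t, nhdsWithin_mono _ hCs ht, hK⟩
  obtain ⟨K, hK⟩ := hVC.exists_lipschitzOnWith_of_compact hCc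
  have hn : IntervalIntegrable (fun s => 1 + ‖w s‖) volume a b :=
    intervalIntegrable_const.add hwi.norm
  refine (hn.absolutelyContinuousOnInterval_intervalIntegral left_mem_uIcc).of_dist_le
    (K := K) ?_
  rw [uIcc_of_le hab]
  have key : ∀ s ∈ Icc a b, ∀ r ∈ Icc a b, s ≤ r → dist (V s (x s)) (V r (x r)) ≤
      K * dist (∫ z in a..s, 1 + ‖w z‖) (∫ z in a..r, 1 + ‖w z‖) := by
    intro s hs r hr hsr
    refine (hK.dist_le_mul _ ⟨s, hs, rfl⟩ _ ⟨r, hr, rfl⟩).trans ?_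
    refine mul_le_mul_of_nonneg_left ?_ K.2
    have hnsub : ∀ s ∈ Icc a b, ∀ r ∈ Icc a b,
        IntervalIntegrable (fun s => 1 + ‖w s‖) volume s r := fun s hs r hr =>
      hn.mono_set (by rw [uIcc_of_le hab]; exact uIcc_subset_Icc hs hr)
    rw [dist_comm (∫ z in a..s, 1 + ‖w z‖), Real.dist_eq,
      intervalIntegral.integral_interval_sub_left
      (hnsub a (left_mem_Icc.2 hab) r hr) (hnsub a (left_mem_Icc.2 hab) s hs),
      intervalIntegral.integral_add intervalIntegrable_const (hsub s hs r hr).norm,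
      intervalIntegral.integral_const, smul_eq_mul, mul_one]
    have h1 : ‖∫ z in s..r, w z‖ ≤ ∫ z in s..r, ‖w z‖ :=
      intervalIntegral.norm_integral_le_integral_norm hsr
    refine le_trans ?_ (le_abs_self _)
    rw [Prod.dist_eq]
    refine max_le ?_ ?_
    · rw [dist_comm, Real.dist_eq, abs_of_nonneg (sub_nonneg.2 hsr)]
      linarith [norm_nonneg (∫ z in s..r, w z)]
    · rw [dist_comm, dist_eq_norm, hxsub r hr s hs]
      linarith [sub_nonneg.2 hsr]
  intro s hs r hr
  rcases le_total s r with h | h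
  · exact key s hs r hr h
  · rw [dist_comm, dist_comm (∫ z in a..s, 1 + ‖w z‖)]
    exact key r hr s hs h

/-- Along a differentiable curve, the Dini derivative is the derivative of the composition. -/
theorem LocLipschitzOn.limsup_eq_of_hasDerivAt {E : Type*} [NormedAddCommGroup E]
    [NormedSpace ℝ E] {V : ℝ → E → ℝ} {x : ℝ → E} {w : E} {s y' : ℝ}
    (hV : LocLipschitzOn (Ici (0 : ℝ) ×ˢ (univ : Set E)) fun q : ℝ × E => V q.1 q.2)
    (hs : 0 ≤ s) (hx : HasDerivAt x w s) (hy : HasDerivAt (fun r => V r (x r)) y' s) :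
    limsup (fun d : ℝ => (V (s + d) (x s + d • w) - V s (x s)) / d) (nhdsWithin 0 (Ioi 0))
      = y' := by
  apply Tendsto.limsup_eq
  obtain ⟨K, t, ht, hK⟩ := hV (s, x s) ⟨hs, mem_univ _⟩
  have hcurve : ∀ g : ℝ → E, Tendsto g (nhdsWithin 0 (Ioi 0)) (nhds (x s)) →
      ∀ᶠ d in nhdsWithin (0 : ℝ) (Ioi 0), (s + d, g d) ∈ t := by
    intro g hg
    refine Tendsto.eventually_mem (f := fun d => (s + d, g d))
      (tendsto_nhdsWithin_iff.2 ⟨?_, ?_⟩) ht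
    · refine Tendsto.prodMk_nhds ?_ hg
      exact (Continuous.tendsto' (by fun_prop) 0 s (by simp)).mono_left nhdsWithin_le_nhds
    · filter_upwards [self_mem_nhdsWithin] with d hd
      exact ⟨add_nonneg hs (le_of_lt hd), mem_univ _⟩
  have h1 := hcurve (fun d => x (s + d)) (by
    have : Tendsto (fun d : ℝ => s + d) (nhdsWithin 0 (Ioi 0)) (nhds s) :=
      (Continuous.tendsto' (by fun_prop) 0 s (by simp)).mono_left nhdsWithin_le_nhds
    exact hx.continuousAt.tendsto.comp this)
  have h2 := hcurve (fun d => x s + d • w)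
    ((Continuous.tendsto' (by fun_prop) 0 (x s) (by simp)).mono_left nhdsWithin_le_nhds)
  have hxs := hx.tendsto_slope_zero_right
  have hys := hy.tendsto_slope_zero_right
  have herr : Tendsto (fun d : ℝ => K * ‖d⁻¹ • (x (s + d) - x s) - w‖) (nhdsWithin 0 (Ioi 0))
      (nhds 0) := by
    have := ((hxs.sub_const w).norm).const_mul (K : ℝ)
    simpa using this
  have hdiff : Tendsto (fun d : ℝ => (V (s + d) (x s + d • w) - V s (x s)) / d -
      d⁻¹ • (V (s + d) (x (s + d)) - V s (x s))) (nhdsWithin 0 (Ioi 0)) (nhds 0) := by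
    refine squeeze_zero_norm' ?_ herr
    filter_upwards [h1, h2, self_mem_nhdsWithin] with d hd1 hd2 hd
    have hd : 0 < d := hd
    have hdist := hK.dist_le_mul _ hd2 _ hd1
    rw [Prod.dist_eq, dist_self, max_eq_right dist_nonneg, Real.dist_eq, dist_eq_norm] at hdist
    have e1 : (V (s + d) (x s + d • w) - V s (x s)) / d -
        d⁻¹ • (V (s + d) (x (s + d)) - V s (x s)) =
        d⁻¹ * (V (s + d) (x s + d • w) - V (s + d) (x (s + d))) := by
      rw [smul_eq_mul]; ring
    have e2 : d⁻¹ • (x (s + d) - x s) - w = -(d⁻¹ • (x s + d • w - x (s + d))) := by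
      rw [smul_sub, smul_sub, smul_add, inv_smul_smul₀ hd.ne']; abel
    rw [e1, e2, norm_neg, norm_smul, norm_mul, mul_left_comm]
    exact mul_le_mul_of_nonneg_left hdist (norm_nonneg _)
  simpa using hdiff.add hys

/-- Exponential estimate along an absolutely continuous curve on which the Dini derivative of a
locally Lipschitz function satisfies a linear bound. -/
theorem LocLipschitzOn.le_exp_mul_of_dini_le {E : Type*} [NormedAddCommGroup E]
    [NormedSpace ℝ E] [CompleteSpace E] {V : ℝ → E → ℝ} {x w : ℝ → E} {a b c : ℝ}
    (hV : LocLipschitzOn (Ici (0 : ℝ) ×ˢ (univ : Set E)) fun q : ℝ × E => V q.1 q.2)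
    (ha : 0 ≤ a) (hab : a ≤ b) (hw : IntegrableOn w (Icc a b))
    (hx : ∀ s ∈ Icc a b, x s = x a + ∫ r in a..s, w r)
    (hdini : ∀ᵐ s, s ∈ Ioo a b →
      limsup (fun d : ℝ => (V (s + d) (x s + d • w s) - V s (x s)) / d) (nhdsWithin 0 (Ioi 0))
        ≤ -(c * V s (x s))) :
    V b (x b) ≤ Real.exp (-(c * (b - a))) * V a (x a) := by
  refine (hV.absolutelyContinuousOnInterval ha hab hw hx).le_exp_mul hab ?_
  have hwi : IntervalIntegrable w volume a b :=
    (intervalIntegrable_iff_integrableOn_Icc_of_le hab).2 hw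
  filter_upwards [hdini, hwi.ae_hasDerivAt_integral] with s hs hder hmem y' hy
  have hxd : HasDerivAt x (w s) s := by
    have h1 := hder (by rw [uIcc_of_le hab]; exact Ioo_subset_Icc_self hmem) a left_mem_uIcc
    refine (h1.const_add (x a)).congr_of_eventuallyEq ?_
    filter_upwards [Icc_mem_nhds hmem.1 hmem.2] with r hr using hx r hr
  rw [← hV.limsup_eq_of_hasDerivAt (ha.trans hmem.1.le) hxd hy]
  exact hs hmem

/-! ### Comparison functions -/

namespace ClassKInf

variable {α β ψ : ℝ → ℝ}

theorem nonneg (h : ClassKInf α) {r : ℝ} (hr : 0 ≤ r) : 0 ≤ α r :=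
  h.2.2.1 ▸ h.2.1.monotoneOn self_mem_Ici hr hr

theorem exists_inverse (h : ClassKInf α) :
    ∃ ψ : ℝ → ℝ, Continuous ψ ∧ StrictMono ψ ∧ Function.Surjective ψ ∧ ψ 0 = 0 ∧
      ∀ r, 0 ≤ r → ψ (α r) = r := by
  obtain ⟨hc, hm, h0, hu⟩ := h
  set A : ℝ → ℝ := fun r => if 0 ≤ r then α r else r with hA
  have hpos : ∀ r, 0 ≤ r → 0 ≤ α r := fun r hr => h0 ▸ hm.monotoneOn self_mem_Ici hr hr
  have hAm : StrictMono A := by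
    intro r s hrs
    simp only [hA]
    split_ifs with h1 h2 h2
    · exact hm h1 h2 hrs
    · exact absurd (h1.trans hrs.le) h2
    · exact (not_le.1 h1).trans_le (hpos s h2)
    · exact hrs
  have hAs : Function.Surjective A := by
    intro y
    by_cases hy : 0 ≤ y
    · obtain ⟨r, hr, hyr⟩ := hu y
      obtain ⟨s, hs, rfl⟩ := intermediate_value_Icc hr (hc.mono Icc_subset_Ici_self)
        (show y ∈ Icc (α 0) (α r) from ⟨by rwa [h0], hyr⟩)
      exact ⟨s, if_pos hs.1⟩
    · exact ⟨y, if_neg hy⟩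
  let e := hAm.orderIsoOfSurjective A hAs
  have he : ∀ r, 0 ≤ r → e.symm (α r) = r := by
    intro r hr
    have : e r = α r := if_pos hr
    rw [← this, e.symm_apply_apply]
  exact ⟨e.symm, e.symm.continuous, e.symm.strictMono, e.symm.surjective,
    by simpa [h0] using he 0 le_rfl, he⟩

theorem const_mul (h : ClassKInf α) {c : ℝ} (hc : 0 < c) : ClassKInf fun r => c * α r := by
  refine ⟨continuousOn_const.mul h.1, fun r hr s hs hrs => ?_, by simp [h.2.2.1], fun M => ?_⟩
  · exact mul_lt_mul_of_pos_left (h.2.1 hr hs hrs) hc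
  · obtain ⟨r, hr, hM⟩ := h.2.2.2 (M / c)
    exact ⟨r, hr, by rwa [div_le_iff₀' hc] at hM⟩

theorem add (hα : ClassKInf α) (hβ : ClassKInf β) : ClassKInf fun r => α r + β r := by
  refine ⟨hα.1.add hβ.1, fun r hr s hs hrs => ?_, by simp [hα.2.2.1, hβ.2.2.1], fun M => ?_⟩
  · exact add_lt_add (hα.2.1 hr hs hrs) (hβ.2.1 hr hs hrs)
  · obtain ⟨r, hr, hM⟩ := hα.2.2.2 M
    exact ⟨r, hr, hM.trans (le_add_of_nonneg_right (hβ.nonneg hr))⟩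

theorem comp_left (h : ClassKInf α) (hc : Continuous ψ) (hm : StrictMono ψ)
    (hs : Function.Surjective ψ) (h0 : ψ 0 = 0) : ClassKInf fun r => ψ (α r) := by
  refine ⟨hc.comp_continuousOn h.1, fun r hr s hs hrs => hm (h.2.1 hr hs hrs),
    by simp [h.2.2.1, h0], fun M => ?_⟩
  obtain ⟨y, rfl⟩ := hs M
  obtain ⟨r, hr, hy⟩ := h.2.2.2 y
  exact ⟨r, hr, hm.monotone hy⟩

theorem classKL_comp_exp (h : ClassKInf α) (hc : Continuous ψ) (hm : StrictMono ψ)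
    (hs : Function.Surjective ψ) (h0 : ψ 0 = 0) (μ : ℝ) {η : ℝ} (hη : 0 < η) :
    ClassKL fun r t => ψ (Real.exp (μ - η * t) * α r) := by
  refine ⟨fun t _ => (h.const_mul (Real.exp_pos _)).comp_left hc hm hs h0,
    fun r hr => ⟨fun s _ t _ hst => hm.monotone ?_, ?_⟩⟩
  · have := h.nonneg hr
    gcongr
  · have h1 : Tendsto (fun t : ℝ => μ - η * t) atTop atBot := by
      simp only [sub_eq_add_neg]
      exact tendsto_atBot_add_const_left _ _
        (tendsto_neg_atTop_atBot.comp (tendsto_id.const_mul_atTop hη))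
    have h2 := (Real.tendsto_exp_atBot.comp h1).mul_const (α r)
    rw [zero_mul] at h2
    have h3 := (hc.tendsto 0).comp h2
    rwa [h0] at h3

end ClassKInf

/-! ### Impulse times, activation times and inputs -/

theorem IsImpulseSeq.eventually_notMem {γ : Set ℝ} (hγ : IsImpulseSeq γ) (q : ℝ) :
    ∀ᶠ s in nhds q, s ∈ γ → s = q := by
  have hfin : ((γ ∩ Iic (q + 1)) \ {q}).Finite := (hγ.2 (q + 1)).subset sdiff_subset
  filter_upwards [hfin.isClosed.isOpen_compl.mem_nhds (fun h => h.2 rfl),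
    Iio_mem_nhds (lt_add_one q)] with s hs hlt hmem
  by_contra hne
  exact hs ⟨⟨hmem, le_of_lt (mem_Iio.1 hlt)⟩, hne⟩

theorem IsImpulseSeq.exists_Ioo_left {γ : Set ℝ} (hγ : IsImpulseSeq γ) {t₀ q : ℝ} (hq : t₀ < q) :
    ∃ p, t₀ ≤ p ∧ p < q ∧ Ioo p q ∩ γ = ∅ := by
  obtain ⟨l, hl, hsub⟩ := exists_Ioc_subset_of_mem_nhds (hγ.eventually_notMem q) ⟨t₀, hq⟩
  refine ⟨max t₀ l, le_max_left _ _, max_lt hq hl, eq_empty_of_forall_notMem ?_⟩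
  rintro s ⟨⟨h1, h2⟩, hs⟩
  exact h2.ne (hsub ⟨(le_max_right _ _).trans_lt h1, h2.le⟩ hs)

theorem IsImpulseSeq.exists_Ioo_right {γ : Set ℝ} (hγ : IsImpulseSeq γ) (q : ℝ) :
    ∃ b, q < b ∧ Ioo q b ∩ γ = ∅ := by
  obtain ⟨b, hb, hsub⟩ := exists_Ico_subset_of_mem_nhds (hγ.eventually_notMem q)
    ⟨q + 1, lt_add_one q⟩
  refine ⟨b, hb, eq_empty_of_forall_notMem ?_⟩
  rintro s ⟨⟨h1, h2⟩, hs⟩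
  exact h1.ne' (hsub ⟨h1.le, h2⟩ hs)

section Input

variable {m : ℕ} {γ : Set ℝ} {u : ℝ → Stt m} {t₀ t : ℝ}

theorem IsImpulseSeq.norm_le_inputNorm (hγ : IsImpulseSeq γ) {q : ℝ} (hq : q ∈ γ)
    (hqI : q ∈ Ioc t₀ t) : ‖u q‖ ≤ inputNorm γ u (Ioc t₀ t) := by
  refine le_max_of_le_right (le_csSup ?_ ⟨q, ⟨hq, hqI⟩, rfl⟩)
  exact (((hγ.2 t).subset (inter_subset_inter_right _ fun _ h => h.2)).image _).bddAbove

theorem inputNorm_nonneg (I : Set ℝ) : 0 ≤ inputNorm γ u I :=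
  le_max_of_le_right (Real.sSup_nonneg (by rintro _ ⟨s, _, rfl⟩; exact norm_nonneg _))

theorem IsInput.ae_norm_le_inputNorm (hu : IsInput u) (ht₀ : 0 ≤ t₀) :
    ∀ᵐ s, s ∈ Ioc t₀ t → ‖u s‖ ≤ inputNorm γ u (Ioc t₀ t) := by
  obtain ⟨C, hC⟩ := hu.2 t
  rw [← ae_restrict_iff' measurableSet_Ioc]
  have hb : IsBoundedUnder (· ≤ ·) (ae (volume.restrict (Ioc t₀ t))) fun s => ‖u s‖ := by
    refine ⟨C, ?_⟩
    rw [eventually_map, ae_restrict_iff' measurableSet_Ioc]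
    filter_upwards [hC] with s hs hmem using hs ⟨ht₀.trans hmem.1.le, hmem.2⟩
  filter_upwards [ae_le_essSup hb] with s hs using le_max_of_le_left hs

end Input

section Switching

variable {Ic Id : Type*} (σ : SwSignal Ic Id)

theorem nJumpsIn_add (Jp : Set (Ic × Ic × Id)) {a b c : ℝ} (hab : a ≤ b) (hbc : b ≤ c) :
    nJumpsIn σ Jp a c = nJumpsIn σ Jp a b + nJumpsIn σ Jp b c := by
  have hfin : ∀ s t, (σ.γ ∩ Ioc s t ∩ {r : ℝ | (σ.σ1m r, σ.σ1 r, σ.σ2 r) ∈ Jp}).Finite :=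
    fun s t => (σ.impulse.2 t).subset fun r hr => ⟨hr.1.1, hr.1.2.2⟩
  unfold nJumpsIn
  rw [← ncard_union_eq ?_ (hfin _ _) (hfin _ _), ← union_inter_distrib_right,
    ← inter_union_distrib_left, Ioc_union_Ioc_eq_Ioc hab hbc]
  exact Set.disjoint_left.2 fun r h1 h2 => absurd h1.1.2.2 (not_le.2 h2.1.2.1)

theorem nJumpsIn_of_Ioo_inter_eq_empty (Jp : Set (Ic × Ic × Id)) {p q : ℝ} (hpq : p < q)
    (hγ : Ioo p q ∩ σ.γ = ∅) :
    nJumpsIn σ Jp p q = if q ∈ σ.γ ∧ (σ.σ1m q, σ.σ1 q, σ.σ2 q) ∈ Jp then 1 else 0 := by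
  have hq : ∀ r ∈ σ.γ ∩ Ioc p q, r = q := fun r hr => by
    by_contra hne
    exact notMem_empty r (hγ ▸ ⟨⟨hr.2.1, lt_of_le_of_ne hr.2.2 hne⟩, hr.1⟩)
  unfold nJumpsIn
  split_ifs with h
  · rw [ncard_eq_one]
    refine ⟨q, eq_singleton_iff_unique_mem.2 ⟨⟨⟨h.1, hpq, le_rfl⟩, h.2⟩, fun r hr => hq r hr.1⟩⟩
  · rw [eq_empty_of_forall_notMem (s := _ ∩ _), ncard_empty]
    intro r hr
    obtain rfl := hq r hr.1
    exact h ⟨hr.1.1, hr.2⟩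

theorem actT_add (A : Set Ic) {a b c : ℝ} (hab : a ≤ b) (hbc : b ≤ c) :
    actT σ A a c = actT σ A a b + actT σ A b c := by
  have hfin : ∀ s t, volume {r : ℝ | r ∈ Ioc s t ∧ σ.σ1 r ∈ A} ≠ ⊤ := fun s t =>
    ((measure_mono fun r hr => hr.1).trans_lt (measure_Ioc_lt_top (a := s) (b := t))).ne
  unfold actT
  rw [← ENNReal.toReal_add (hfin _ _) (hfin _ _),
    ← measure_inter_add_sdiff {r : ℝ | r ∈ Ioc a c ∧ σ.σ1 r ∈ A} (measurableSet_Ioc (a := a) (b := b))]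
  congr 3 <;> ext r <;> simp only [mem_inter_iff, Set.mem_sdiff, mem_ofPred_eq, mem_Ioc] <;> grind

theorem actT_of_Ioo_inter_eq_empty (A : Set Ic) {p q : ℝ} (hp : 0 ≤ p) (hpq : p < q)
    (hγ : Ioo p q ∩ σ.γ = ∅) :
    actT σ A p q = if σ.σ1 p ∈ A then q - p else 0 := by
  have hσ := σ.const1 p q hp hγ
  unfold actT
  split_ifs with h
  · have : volume {r : ℝ | r ∈ Ioc p q ∧ σ.σ1 r ∈ A} = ENNReal.ofReal (q - p) := by
      refine le_antisymm (Real.volume_Ioc ▸ measure_mono fun r hr => hr.1)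
        (Real.volume_Ioo ▸ measure_mono fun r hr => ⟨Ioo_subset_Ioc_self hr, ?_⟩)
      rwa [hσ r (Ioo_subset_Ico_self hr)]
    rw [this, ENNReal.toReal_ofReal (sub_nonneg.2 hpq.le)]
  · have : volume {r : ℝ | r ∈ Ioc p q ∧ σ.σ1 r ∈ A} = 0 := by
      refine measure_mono_null (fun r hr => ?_) (Real.volume_singleton (a := q))
      by_contra hne
      exact h (hσ r ⟨hr.1.1.le, lt_of_le_of_ne hr.1.2 hne⟩ ▸ hr.2)
    rw [this, ENNReal.toReal_zero]

/-- The factor by which the comparison system can grow over the interval `(a, b]`. -/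
def switchGain (As Au : Set Ic) (Js Ju : Set (Ic × Ic × Id)) (cs cu ds du a b : ℝ) : ℝ :=
  ds ^ nJumpsIn σ Js a b * du ^ nJumpsIn σ Ju a b *
    Real.exp (cu * actT σ Au a b - cs * actT σ As a b)

variable {σ} {As Au : Set Ic} {Js Ju : Set (Ic × Ic × Id)} {cs cu ds du a b c : ℝ}

theorem switchGain_nonneg (hds : 0 ≤ ds) (hdu : 0 ≤ du) :
    0 ≤ switchGain σ As Au Js Ju cs cu ds du a b := by
  unfold switchGain; positivity

theorem switchGain_mul (hab : a ≤ b) (hbc : b ≤ c) :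
    switchGain σ As Au Js Ju cs cu ds du a b * switchGain σ As Au Js Ju cs cu ds du b c =
      switchGain σ As Au Js Ju cs cu ds du a c := by
  unfold switchGain
  rw [nJumpsIn_add σ Js hab hbc, nJumpsIn_add σ Ju hab hbc, actT_add σ As hab hbc,
    actT_add σ Au hab hbc, pow_add, pow_add, mul_add, mul_add, add_sub_add_comm, Real.exp_add]
  ring

theorem switchGain_self : switchGain σ As Au Js Ju cs cu ds du a a = 1 := by
  simp [switchGain, nJumpsIn, actT]

theorem switchGain_le_exp {B : ℝ} (hds : 0 ≤ ds) (hdu : 0 < du)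
    (h : (0 < ds ∨ nJumpsIn σ Js a b = 0) →
      (nJumpsIn σ Js a b : ℝ) * Real.log ds + (nJumpsIn σ Ju a b : ℝ) * Real.log du
        - cs * actT σ As a b + cu * actT σ Au a b ≤ B) :
    switchGain σ As Au Js Ju cs cu ds du a b ≤ Real.exp B := by
  unfold switchGain
  have hu : du ^ nJumpsIn σ Ju a b = Real.exp (nJumpsIn σ Ju a b * Real.log du) := by
    rw [Real.exp_nat_mul, Real.exp_log hdu]
  by_cases h0 : 0 < ds ∨ nJumpsIn σ Js a b = 0
  · have hs : ds ^ nJumpsIn σ Js a b = Real.exp (nJumpsIn σ Js a b * Real.log ds) := by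
      rcases h0 with h0 | h0
      · rw [Real.exp_nat_mul, Real.exp_log h0]
      · simp [h0]
    rw [hs, hu, ← Real.exp_add, ← Real.exp_add]
    exact Real.exp_le_exp.2 (by linarith [h h0])
  · push Not at h0
    rw [le_antisymm h0.1 hds, zero_pow h0.2, zero_mul, zero_mul]
    exact (Real.exp_pos _).le

/-- An estimate over all intervals without interior impulses propagates to all intervals. -/
theorem le_switchGain_mul_of_step (hds : 0 ≤ ds) (hdu : 0 ≤ du) {W : ℝ → ℝ} (hab : a ≤ b)
    (hstep : ∀ p q, a ≤ p → p < q → q ≤ b → Ioo p q ∩ σ.γ = ∅ →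
      W q ≤ switchGain σ As Au Js Ju cs cu ds du p q * W p) :
    W b ≤ switchGain σ As Au Js Ju cs cu ds du a b * W a := by
  have hfin : ∀ p q, (Ioo p q ∩ σ.γ).Finite := fun p q =>
    (σ.impulse.2 q).subset fun r hr => ⟨hr.2, hr.1.2.le⟩
  suffices H : ∀ N p q, (Ioo p q ∩ σ.γ).ncard = N → a ≤ p → p < q → q ≤ b →
      W q ≤ switchGain σ As Au Js Ju cs cu ds du p q * W p by
    rcases hab.eq_or_lt with rfl | hlt
    · rw [switchGain_self, one_mul]
    · exact H _ a b rfl le_rfl hlt le_rfl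
  intro N
  induction N using Nat.strong_induction_on with
  | _ N ih =>
    intro p q hN hp hpq hq
    rcases eq_empty_or_nonempty (Ioo p q ∩ σ.γ) with he | ⟨τ, hτ, hτγ⟩
    · exact hstep p q hp hpq hq he
    · have h1 : (Ioo p τ ∩ σ.γ).ncard < N := hN ▸ ncard_lt_ncard
        ⟨fun r hr => ⟨⟨hr.1.1, hr.1.2.trans hτ.2⟩, hr.2⟩, fun hs => (hs ⟨hτ, hτγ⟩).1.2.ne rfl⟩
        (hfin _ _)
      have h2 : (Ioo τ q ∩ σ.γ).ncard < N := hN ▸ ncard_lt_ncard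
        ⟨fun r hr => ⟨⟨hτ.1.trans hr.1.1, hr.1.2⟩, hr.2⟩, fun hs => (hs ⟨hτ, hτγ⟩).1.1.ne rfl⟩
        (hfin _ _)
      have h3 := ih _ h1 p τ rfl hp hτ.1 (hτ.2.le.trans hq)
      have h4 := ih _ h2 τ q rfl (hp.trans hτ.1.le) hτ.2 hq
      calc W q ≤ _ := h4
        _ ≤ _ := mul_le_mul_of_nonneg_left h3 (switchGain_nonneg hds hdu)
        _ = _ := by rw [← switchGain_mul hτ.1.le hτ.2.le]; ring

end Switching

/-! ### Solutions between impulses -/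

theorem IsSolution.exists_left_limit {n m : ℕ} {γ : Set ℝ} {f g : ℝ → Stt n → Stt m → Stt n}
    {t₀ : ℝ} {x₀ : Stt n} {u : ℝ → Stt m} {T : EReal} {x : ℝ → Stt n}
    (hx : IsSolution γ f g t₀ x₀ u T x) (hγ : IsImpulseSeq γ) {q : ℝ} (hq : t₀ < q)
    (hqT : (q : EReal) < T) :
    ∃ L, Tendsto x (nhdsWithin q (Iio q)) (nhds L) ∧ (q ∈ γ → x q = L + g q L (u q)) ∧
      (q ∉ γ → x q = L) := by
  by_cases hqγ : q ∈ γ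
  · obtain ⟨L, hL, hxq⟩ := hx.jump q hqγ hq hqT
    exact ⟨L, hL, fun _ => hxq, fun h => absurd hqγ h⟩
  refine ⟨x q, ?_, fun h => absurd h hqγ, fun _ => rfl⟩
  obtain ⟨p, hp, hpq, hIoo⟩ := hγ.exists_Ioo_left hq
  have hIoc : ∀ r ≤ q, Ioc p r ∩ γ = ∅ := fun r hr => eq_empty_of_forall_notMem fun s hs => by
    rcases (hs.1.2.trans hr).eq_or_lt with rfl | hlt
    · exact hqγ hs.2
    · exact notMem_empty s (hIoo ▸ ⟨⟨hs.1.1, hlt⟩, hs.2⟩)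
  have hint := (hx.flow p q hp hpq.le hqT (hIoc q le_rfl)).1
  have hc := intervalIntegral.continuousOn_primitive_interval'
    ((intervalIntegrable_iff_integrableOn_Icc_of_le hpq.le).2 hint) left_mem_uIcc
  rw [uIcc_of_le hpq.le] at hc
  have hxc : ContinuousOn x (Icc p q) := (continuousOn_const.add hc).congr fun r hr =>
    (hx.flow p r hp hr.1 ((EReal.coe_le_coe_iff.2 hr.2).trans_lt hqT) (hIoc r hr.2)).2
  refine (hxc q (right_mem_Icc.2 hpq.le)).mono_left ?_
  rw [← nhdsWithin_Ico_eq_nhdsLT hpq]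
  exact nhdsWithin_mono _ Ico_subset_Icc_self

section SwitchedSolution

variable {n m : ℕ} {Ic Id : Type*} {σ : SwSignal Ic Id}

theorem SwSignal.σ1_eq_of_notMem {p q : ℝ} (hp : 0 ≤ p) (hpq : p < q)
    (hγ : Ioo p q ∩ σ.γ = ∅) (hq : q ∉ σ.γ) : σ.σ1 q = σ.σ1 p := by
  obtain ⟨b, hb, hqb⟩ := σ.impulse.exists_Ioo_right q
  refine σ.const1 p b hp (eq_empty_of_forall_notMem fun s hs => ?_) q ⟨hpq.le, hb⟩
  rcases lt_trichotomy s q with h | rfl | h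
  · exact notMem_empty s (hγ ▸ ⟨⟨hs.1.1, h⟩, hs.2⟩)
  · exact hq hs.2
  · exact notMem_empty s (hqb ▸ ⟨⟨h, hs.1.2⟩, hs.2⟩)

theorem SwSignal.eventually_σ1_eq {p q : ℝ} (hp : 0 ≤ p) (hpq : p < q)
    (hγ : Ioo p q ∩ σ.γ = ∅) : ∀ᶠ s in nhdsWithin q (Iio q), σ.σ1 s = σ.σ1 p := by
  filter_upwards [Ico_mem_nhdsLT hpq] with s hs using σ.const1 p q hp hγ s hs

theorem SwSignal.σ1m_eq_of_mem {p q : ℝ} (hp : 0 ≤ p) (hpq : p < q)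
    (hγ : Ioo p q ∩ σ.γ = ∅) (hq : q ∈ σ.γ) : σ.σ1m q = σ.σ1 p := by
  obtain ⟨s, hs, hs'⟩ := ((σ.leftlim q hq).and (σ.eventually_σ1_eq hp hpq hγ)).exists
  exact hs.symm.trans hs'

theorem LocLipschitzOn.tendsto_comp_left {E : Type*} [PseudoMetricSpace E] {V : ℝ → E → ℝ}
    (hV : LocLipschitzOn (Ici (0 : ℝ) ×ˢ (univ : Set E)) fun q : ℝ × E => V q.1 q.2)
    {x : ℝ → E} {q : ℝ} {L : E} (hq : 0 < q) (hL : Tendsto x (nhdsWithin q (Iio q)) (nhds L)) :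
    Tendsto (fun r => V r (x r)) (nhdsWithin q (Iio q)) (nhds (V q L)) := by
  have hc : ContinuousWithinAt (fun q : ℝ × E => V q.1 q.2) (Ici (0 : ℝ) ×ˢ univ) (q, L) :=
    LocallyLipschitzOn.continuousOn (fun _ h => hV _ h) (q, L) ⟨hq.le, mem_univ _⟩
  refine Tendsto.comp (f := fun r => (r, x r)) hc (tendsto_nhdsWithin_iff.2
    ⟨(tendsto_id.mono_left nhdsWithin_le_nhds).prodMk_nhds hL, ?_⟩)
  filter_upwards [mem_nhdsWithin_of_mem_nhds (Ioi_mem_nhds hq)] with r hr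
  exact ⟨le_of_lt (mem_Ioi.1 hr), mem_univ _⟩

variable {F : Ic → ℝ → Stt n → Stt m → Stt n} {G : Id → ℝ → Stt n → Stt m → Stt n}
  {t₀ : ℝ} {x₀ : Stt n} {u : ℝ → Stt m} {T : EReal} {x : ℝ → Stt n}

theorem IsSolution.left_limit_le_exp_mul {V : ℝ → Stt n → ℝ} {c p q : ℝ} {L : Stt n}
    (hx : IsSolution σ.γ (swF F σ) (swG G σ) t₀ x₀ u T x)
    (hV : LocLipschitzOn (Ici (0 : ℝ) ×ˢ (univ : Set (Stt n)))
      fun q : ℝ × Stt n => V q.1 q.2)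
    (ht₀ : 0 ≤ t₀) (hp : t₀ ≤ p) (hpq : p < q) (hqT : (q : EReal) < T)
    (hγ : Ioo p q ∩ σ.γ = ∅) (hL : Tendsto x (nhdsWithin q (Iio q)) (nhds L))
    (hdini : ∀ᵐ s, s ∈ Ioo p q → DiniAlong (F (σ.σ1 p)) V s (x s) (u s) ≤ -(c * V s (x s))) :
    V q L ≤ Real.exp (-(c * (q - p))) * V p (x p) := by
  have hp0 := ht₀.trans hp
  have hVL := hV.tendsto_comp_left (hp0.trans_lt hpq) hL
  have hexp : Tendsto (fun r => Real.exp (-(c * (r - p))) * V p (x p))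
      (nhdsWithin q (Iio q)) (nhds (Real.exp (-(c * (q - p))) * V p (x p))) :=
    (Continuous.tendsto (by fun_prop) q).mono_left nhdsWithin_le_nhds
  refine le_of_tendsto_of_tendsto hVL hexp ?_
  filter_upwards [Ioo_mem_nhdsLT hpq] with r hr
  have hflow : ∀ s ∈ Icc p r, IntegrableOn (fun s => swF F σ s (x s) (u s)) (Icc p s) ∧
      x s = x p + ∫ z in p..s, swF F σ z (x z) (u z) := fun s hs =>
    hx.flow p s hp hs.1 ((EReal.coe_lt_coe_iff.2 (hs.2.trans_lt hr.2)).trans hqT)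
      (eq_empty_of_forall_notMem fun z hz => notMem_empty z
        (hγ ▸ ⟨⟨hz.1.1, (hz.1.2.trans hs.2).trans_lt hr.2⟩, hz.2⟩))
  refine hV.le_exp_mul_of_dini_le hp0 hr.1.le (hflow r (right_mem_Icc.2 hr.1.le)).1
    (fun s hs => (hflow s hs).2) ?_
  filter_upwards [hdini] with s hs hmem
  have hmem' : s ∈ Ioo p q := ⟨hmem.1, hmem.2.trans hr.2⟩
  have := hs hmem'
  simp only [swF, σ.const1 p q hp0 hγ s (Ioo_subset_Ico_self hmem')]
  exact this

variable {h0 h : ℝ → Stt n → ℝ} {J : Set (Ic × Ic × Id)} {Ics Icn Icu : Set Ic}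
  {Js Jn Ju : Set (Ic × Ic × Id)} {cs cu ds du : ℝ} {v : Ic → ℝ → Stt n → ℝ}
  {φ1 φ2 χ π : ℝ → ℝ} {U : ℝ}

/-- Comparison estimate over an interval without interior impulses on which the Lyapunov function
dominates the input. -/
theorem IsSolution.le_switchGain_mul_of_Ioo_inter_eq_empty
    (hA2 : Assumption2 F G h0 h J v φ1 φ2 χ π
      (fun i _ r => if i ∈ Ics then cs * r else if i ∈ Icn then 0 else -(cu * r))
      (fun e _ r => if e ∈ Js then ds * r else if e ∈ Jn then r else du * r))
    (hσ : InSW σ J) (hIuniv : Ics ∪ Icn ∪ Icu = univ)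
    (hIdisj : Disjoint Ics Icn ∧ Disjoint Ics Icu ∧ Disjoint Icn Icu)
    (hJuniv : Js ∪ Jn ∪ Ju = J)
    (hJdisj : Disjoint Js Jn ∧ Disjoint Js Ju ∧ Disjoint Jn Ju)
    (hds : 0 ≤ ds) (hdu : 0 ≤ du)
    (hx : IsSolution σ.γ (swF F σ) (swG G σ) t₀ x₀ u T x) (ht₀ : 0 ≤ t₀) {p q : ℝ}
    (hp : t₀ ≤ p) (hpq : p < q) (hqT : (q : EReal) < T) (hγ : Ioo p q ∩ σ.γ = ∅)
    (hU : ∀ᵐ s, s ∈ Ioo p q → ‖u s‖ ≤ U) (hUq : q ∈ σ.γ → ‖u q‖ ≤ U)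
    (hW : ∀ s ∈ Ioo p q, χ U ≤ v (σ.σ1 s) s (x s)) :
    v (σ.σ1 q) q (x q) ≤
      switchGain σ Ics Icu Js Ju cs cu ds du p q * v (σ.σ1 p) p (x p) := by
  obtain ⟨-, -, hχ, -, hV, -, -, -, hdini, hjump, -⟩ := hA2
  have hp0 := ht₀.trans hp
  obtain ⟨L, hL, hLγ, hLn⟩ := hx.exists_left_limit σ.impulse (hp.trans_lt hpq) hqT
  have hχmono : ∀ z : Stt m, ‖z‖ ≤ U → χ ‖z‖ ≤ χ U := fun z hz =>
    hχ.2.1.monotoneOn (norm_nonneg z) ((norm_nonneg z).trans hz) hz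
  have hW' : ∀ s ∈ Ioo p q, χ U ≤ v (σ.σ1 p) s (x s) := fun s hs =>
    σ.const1 p q hp0 hγ s (Ioo_subset_Ico_self hs) ▸ hW s hs
  have hVL : χ U ≤ v (σ.σ1 p) q L := ge_of_tendsto
    ((hV (σ.σ1 p)).tendsto_comp_left (hp0.trans_lt hpq) hL)
    (by filter_upwards [Ioo_mem_nhdsLT hpq] with s hs using hW' s hs)
  have hflow : v (σ.σ1 p) q L ≤ Real.exp (cu * actT σ Icu p q - cs * actT σ Ics p q) *
      v (σ.σ1 p) p (x p) := by
    have hest := hx.left_limit_le_exp_mul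
      (c := if σ.σ1 p ∈ Ics then cs else if σ.σ1 p ∈ Icn then 0 else -cu)
      (hV (σ.σ1 p)) ht₀ hp hpq hqT hγ hL (by
        filter_upwards [hU] with s hs hmem
        refine (hdini (σ.σ1 p) s (x s) (u s) (hp0.trans hmem.1.le)
          ((hχmono _ (hs hmem)).trans (hW' s hmem))).trans (le_of_eq ?_)
        beta_reduce
        split_ifs <;> ring)
    convert hest using 3
    rw [actT_of_Ioo_inter_eq_empty σ Ics hp0 hpq hγ, actT_of_Ioo_inter_eq_empty σ Icu hp0 hpq hγ]
    have hmem : σ.σ1 p ∈ Ics ∪ Icn ∪ Icu := hIuniv ▸ mem_univ _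
    by_cases h1 : σ.σ1 p ∈ Ics
    · simp [h1, Set.disjoint_left.1 hIdisj.2.1 h1]
    · by_cases h2 : σ.σ1 p ∈ Icn
      · simp [h1, h2, Set.disjoint_left.1 hIdisj.2.2 h2]
      · have h3 : σ.σ1 p ∈ Icu := by simpa [h1, h2] using hmem
        simp [h1, h2, h3]
  unfold switchGain
  rw [nJumpsIn_of_Ioo_inter_eq_empty σ Js hpq hγ, nJumpsIn_of_Ioo_inter_eq_empty σ Ju hpq hγ]
  by_cases hq : q ∈ σ.γ
  · rw [hLγ hq]
    have hm := σ.σ1m_eq_of_mem hp0 hpq hγ hq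
    have hJ := hσ q hq
    rw [mul_assoc]
    have hj := hjump _ _ _ (hm ▸ hJ) q L (u q) (hp0.trans hpq.le)
      ((hχmono _ (hUq hq)).trans hVL)
    refine hj.trans ?_
    simp only [hq, true_and, hm]
    rw [hm, ← hJuniv] at hJ
    set e := (σ.σ1 p, σ.σ1 q, σ.σ2 q)
    by_cases h1 : e ∈ Js
    · simpa [h1, Set.disjoint_left.1 hJdisj.2.1 h1] using mul_le_mul_of_nonneg_left hflow hds
    · by_cases h2 : e ∈ Jn
      · simpa [h1, h2, Set.disjoint_left.1 hJdisj.2.2 h2] using hflow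
      · have h3 : e ∈ Ju := by simpa [h1, h2] using hJ
        simpa [h1, h2, h3] using mul_le_mul_of_nonneg_left hflow hdu
  · rw [hLn hq, σ.σ1_eq_of_notMem hp0 hpq hγ hq]
    simpa [hq] using hflow

/-- At a time where the Lyapunov function has just been dominated by the input, it is bounded by a
gain of the input. -/
theorem IsSolution.le_of_frequently_lt
    (hA2 : Assumption2 F G h0 h J v φ1 φ2 χ π
      (fun i _ r => if i ∈ Ics then cs * r else if i ∈ Icn then 0 else -(cu * r))
      (fun e _ r => if e ∈ Js then ds * r else if e ∈ Jn then r else du * r))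
    (hh : ∀ (t : ℝ) (ξ : Stt n), 0 ≤ t → 0 ≤ h t ξ)
    (hσ : InSW σ J) (hds1 : ds ≤ 1) (hdu : 1 ≤ du)
    (hx : IsSolution σ.γ (swF F σ) (swG G σ) t₀ x₀ u T x) (ht₀ : 0 ≤ t₀) {q : ℝ}
    (hq : t₀ < q) (hqT : (q : EReal) < T) (hU0 : 0 ≤ U) (hUq : q ∈ σ.γ → ‖u q‖ ≤ U)
    (hW : ∃ᶠ s in nhdsWithin q (Iio q), v (σ.σ1 s) s (x s) < χ U) :
    v (σ.σ1 q) q (x q) ≤ π U + du * χ U := by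
  obtain ⟨hφ1, -, hχ, hπ, hV, -, -, hφ, -, hjump, hjump'⟩ := hA2
  have hq0 := ht₀.trans_lt hq
  obtain ⟨p, hp, hpq, hγ⟩ := σ.impulse.exists_Ioo_left hq
  have hp0 := ht₀.trans hp
  obtain ⟨L, hL, hLγ, hLn⟩ := hx.exists_left_limit σ.impulse hq hqT
  have hVL : v (σ.σ1 p) q L ≤ χ U := by
    by_contra! hlt
    have hev := ((hV (σ.σ1 p)).tendsto_comp_left hq0 hL).eventually_const_lt hlt
    refine hW ?_
    filter_upwards [hev, σ.eventually_σ1_eq hp0 hpq hγ] with s hs hs'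
    rw [hs']
    exact hs.not_gt
  have hχ0 := hχ.nonneg hU0
  have hπ0 := hπ.nonneg hU0
  by_cases hqγ : q ∈ σ.γ
  · rw [hLγ hqγ]
    have hJ := hσ q hqγ
    rw [σ.σ1m_eq_of_mem hp0 hpq hγ hqγ] at hJ
    rcases le_total (v (σ.σ1 p) q L) (χ ‖u q‖) with hle | hle
    · refine (hjump' _ _ _ hJ q L (u q) hq0.le hle).trans ?_
      have : π ‖u q‖ ≤ π U := hπ.2.1.monotoneOn (norm_nonneg _) hU0 (hUq hqγ)
      nlinarith
    · refine (hjump _ _ _ hJ q L (u q) hq0.le hle).trans ?_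
      have hv0 : 0 ≤ v (σ.σ1 p) q L :=
        (hφ1.nonneg (hh q L hq0.le)).trans (hφ (σ.σ1 p) q L hq0.le).1
      simp only
      split_ifs <;> nlinarith
  · rw [hLn hqγ, σ.σ1_eq_of_notMem hp0 hpq hγ hqγ]
    nlinarith

end SwitchedSolution

/-- Theorem 5(a): weak `(h⁰,h)`-ISS of the switched impulsive family under
condition (24). -/
theorem stmt10 {n m : ℕ} {Ic Id : Type*}
    (F : Ic → ℝ → Stt n → Stt m → Stt n) (G : Id → ℝ → Stt n → Stt m → Stt n)
    (h0 h : ℝ → Stt n → ℝ)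
    (hh0 : ∀ (t : ℝ) (ξ : Stt n), 0 ≤ t → 0 ≤ h0 t ξ)
    (hh : ∀ (t : ℝ) (ξ : Stt n), 0 ≤ t → 0 ≤ h t ξ)
    (J : Set (Ic × Ic × Id)) (hJ : J.Nonempty)
    (SW : Set (SwSignal Ic Id)) (hSW : ∀ σ ∈ SW, InSW σ J)
    (Ics Icn Icu : Set Ic)
    (hIuniv : Ics ∪ Icn ∪ Icu = Set.univ)
    (hIdisj : Disjoint Ics Icn ∧ Disjoint Ics Icu ∧ Disjoint Icn Icu)
    (Js Jn Ju : Set (Ic × Ic × Id))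
    (hJuniv : Js ∪ Jn ∪ Ju = J)
    (hJdisj : Disjoint Js Jn ∧ Disjoint Js Ju ∧ Disjoint Jn Ju)
    (cs cu ds du : ℝ) (hcs : 0 < cs) (hcu : 0 < cu)
    (hds0 : 0 ≤ ds) (hds1 : ds < 1) (hdu : 1 < du)
    (v : Ic → ℝ → Stt n → ℝ) (φ1 φ2 χ π : ℝ → ℝ)
    (hA2 : Assumption2 F G h0 h J v φ1 φ2 χ π
      (fun i _ r => if i ∈ Ics then cs * r else if i ∈ Icn then 0 else -(cu * r))
      (fun e _ r => if e ∈ Js then ds * r else if e ∈ Jn then r else du * r))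
    (η μ : ℝ) (hη : 0 < η) (hμ : 0 < μ)
    (hcond : ∀ σ ∈ SW, ∀ t0 t : ℝ, 0 ≤ t0 → t0 ≤ t →
      (0 < ds ∨ nJumpsIn σ Js t0 t = 0) →
      (nJumpsIn σ Js t0 t : ℝ) * Real.log ds + (nJumpsIn σ Ju t0 t : ℝ) * Real.log du
        - cs * actT σ Ics t0 t + cu * actT σ Icu t0 t ≤ μ - η * (t - t0)) :
    SwWeaklyISS F G SW h0 h := by
  obtain ⟨hφ1, hφ2, hχ, hπ, -, -, -, hφ, -⟩ := id hA2
  have hdu0 : 0 < du := one_pos.trans hdu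
  obtain ⟨ψ, hψc, hψm, hψs, hψ0, hψ⟩ := hφ1.exists_inverse
  refine ⟨fun r t => ψ (Real.exp (μ - η * t) * φ2 r),
    fun r => ψ (Real.exp μ * (π r + du * χ r)),
    hφ2.classKL_comp_exp hψc hψm hψs hψ0 μ hη,
    ((hπ.add (hχ.const_mul hdu0)).const_mul (Real.exp_pos _)).comp_left hψc hψm hψs hψ0,
    fun σ hσ t₀ x₀ u T x ht₀ hu hmax t ht htT => ?_⟩
  have hx := hmax.1
  have hψpos : ∀ r, 0 ≤ r → 0 ≤ ψ r := fun r hr => hψ0 ▸ hψm.monotone hr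
  set U := inputNorm σ.γ u (Ioc t₀ t)
  have hU0 : 0 ≤ U := inputNorm_nonneg _
  have hUae : ∀ᵐ s, s ∈ Ioc t₀ t → ‖u s‖ ≤ U := hu.ae_norm_le_inputNorm ht₀
  have hUγ : ∀ q, t₀ < q → q ≤ t → q ∈ σ.γ → ‖u q‖ ≤ U := fun q h1 h2 hq =>
    σ.impulse.norm_le_inputNorm hq ⟨h1, h2⟩
  have hlt : ∀ q, q ≤ t → (q : EReal) < T := fun q hq => (EReal.coe_le_coe_iff.2 hq).trans_lt htT
  set W : ℝ → ℝ := fun s => v (σ.σ1 s) s (x s) with hWdef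
  have hW0 : ∀ s, t₀ ≤ s → 0 ≤ W s := fun s hs =>
    (hφ1.nonneg (hh s (x s) (ht₀.trans hs))).trans (hφ _ s (x s) (ht₀.trans hs)).1
  have hχ0 := hχ.nonneg hU0
  have hπ0 := hπ.nonneg hU0
  have hB0 : 0 ≤ π U + du * χ U := by positivity
  have hdecay : ∀ a, t₀ ≤ a → a ≤ t → (∀ s ∈ Ioo a t, χ U ≤ W s) →
      W t ≤ Real.exp (μ - η * (t - a)) * W a := fun a ha hat hWa =>
    (le_switchGain_mul_of_step hds0 hdu0.le hat fun p q hp hpq hq hγ =>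
      hx.le_switchGain_mul_of_Ioo_inter_eq_empty hA2 (hSW σ hσ) hIuniv hIdisj hJuniv hJdisj
        hds0 hdu0.le ht₀ (ha.trans hp) hpq (hlt q hq) hγ
        (by
          filter_upwards [hUae] with s hs hmem
          exact hs ⟨(ha.trans hp).trans_lt hmem.1, hmem.2.le.trans hq⟩)
        (hUγ q ((ha.trans hp).trans_lt hpq) hq)
        (fun s hs => hWa s ⟨hp.trans_lt hs.1, hs.2.trans_le hq⟩)).trans
      (mul_le_mul_of_nonneg_right
        (switchGain_le_exp hds0 hdu0 (hcond σ hσ a t (ht₀.trans ha) hat)) (hW0 a ha))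
  have hht : h t (x t) ≤ ψ (W t) := by
    rw [← hψ _ (hh t (x t) (ht₀.trans ht))]
    exact hψm.monotone (hφ _ t (x t) (ht₀.trans ht)).1
  have hA0 : 0 ≤ Real.exp (μ - η * (t - t₀)) * φ2 (h0 t₀ x₀) :=
    mul_nonneg (Real.exp_pos _).le (hφ2.nonneg (hh0 t₀ x₀ ht₀))
  by_cases hall : ∀ s ∈ Ioo t₀ t, χ U ≤ W s
  · have hWt : W t ≤ Real.exp (μ - η * (t - t₀)) * φ2 (h0 t₀ x₀) := by
      refine (hdecay t₀ le_rfl ht hall).trans (mul_le_mul_of_nonneg_left ?_ (Real.exp_pos _).le)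
      simpa only [hWdef, hx.init] using (hφ (σ.σ1 t₀) t₀ x₀ ht₀).2
    exact (hht.trans (hψm.monotone hWt)).trans
      (le_add_of_nonneg_right (hψpos _ (by positivity)))
  · have hWt : W t ≤ Real.exp μ * (π U + du * χ U) := by
      set S := {s | s ∈ Ioo t₀ t ∧ W s < χ U}
      have hne : S.Nonempty := by
        push Not at hall
        exact hall
      have hbdd : BddAbove S := ⟨t, fun s hs => hs.1.2.le⟩
      obtain ⟨s₀, hs₀⟩ := hne
      have hlts : t₀ < sSup S := hs₀.1.1.trans_le (le_csSup hbdd hs₀)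
      have hlet : sSup S ≤ t := csSup_le ⟨s₀, hs₀⟩ fun s hs => hs.1.2.le
      have habove : ∀ s ∈ Ioo (sSup S) t, χ U ≤ W s := fun s hs => by
        by_contra! hc
        exact (le_csSup hbdd ⟨⟨hlts.trans hs.1, hs.2⟩, hc⟩).not_gt hs.1
      have hWs : W (sSup S) ≤ π U + du * χ U := by
        by_cases hmem : sSup S ∈ S
        · nlinarith [hmem.2]
        · refine hx.le_of_frequently_lt hA2 hh (hSW σ hσ) hds1.le hdu.le ht₀ hlts (hlt _ hlet)
            hU0 (hUγ _ hlts hlet) (frequently_iff.2 fun {V} hV => ?_)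
          obtain ⟨l, hl, hlV⟩ := (mem_nhdsLT_iff_exists_Ioo_subset' hlts).1 hV
          obtain ⟨s, hs, hls⟩ := exists_lt_of_lt_csSup ⟨s₀, hs₀⟩ hl
          refine ⟨s, hlV ⟨hls, (le_csSup hbdd hs).lt_of_ne ?_⟩, hs.2⟩
          rintro rfl
          exact hmem hs
      refine (hdecay _ hlts.le hlet habove).trans ?_
      refine mul_le_mul (Real.exp_le_exp.2 ?_) hWs (hW0 _ hlts.le) (Real.exp_pos _).le
      have := mul_nonneg hη.le (sub_nonneg.2 hlet)
      linarith
    exact (hht.trans (hψm.monotone hWt)).trans (le_add_of_nonneg_left (hψpos _ hA0))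

end
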